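/- For complex z with |arg z| < π/2, complex α, and real c > -Re(α), one has (1/(2πi)) ∫_{c-i∞}^{c+i∞} Γ(s+α) z^{-s} ds = z^α e^{-z} (the Cahen–Mellin integral). -/

import Mathlib

open MeasureTheory Set

lemma aux_int (r : ℂ) (hr : 0 < r.re) (a : ℂ) (ha : 0 < a.re) :
    IntegrableOn (fun t : ℝ => (t:ℂ)^(a-1) • Complex.exp (-(r*t))) (Ioi 0) := by
  have h := integrableOn_rpow_mul_exp_neg_mul_rpow (s := a.re - 1) (p := 1) (b := r.re) (by linarith) one_pos hr
  refine h.mono' ?_ ?_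
  · refine ContinuousOn.aestronglyMeasurable ?_ measurableSet_Ioi
    intro t ht
    have : (t:ℂ) ∈ Complex.slitPlane := by simpa using ht
    exact (ContinuousAt.smul (ContinuousAt.comp (f := fun t : ℝ => (t:ℂ)) (g := fun t : ℂ => t^(a-1)) (continuousAt_cpow_const this) (by fun_prop)) (by fun_prop)).continuousWithinAt
  · refine (ae_restrict_mem measurableSet_Ioi).mono fun t ht => ?_
    rw [norm_smul, Complex.norm_cpow_eq_rpow_re_of_pos ht, Complex.norm_exp]
    simp

lemma aux_int_real (b s : ℝ) (hb : 0 < b) (hs : -1 < s) :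
    IntegrableOn (fun t : ℝ => t^s * Real.exp (-(b*t))) (Ioi 0) := by
  simpa using integrableOn_rpow_mul_exp_neg_mul_rpow (s := s) (p := 1) (b := b) hs one_pos hb

lemma aux_deriv (r : ℂ) (hr : 0 < r.re) (a : ℂ) (ha : 0 < a.re) :
    DifferentiableAt ℂ (fun r : ℂ => ∫ t in Ioi (0:ℝ), (t:ℂ)^(a-1) * Complex.exp (-(r*t))) r := by
  have hlt : r.re / 2 < r.re := by linarith
  have hs : {w : ℂ | r.re / 2 < w.re} ∈ nhds r :=
    (isOpen_lt continuous_const Complex.continuous_re).mem_nhds hlt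
  refine (hasDerivAt_integral_of_dominated_loc_of_deriv_le
    (F := fun (r : ℂ) (t : ℝ) => (t:ℂ)^(a-1) * Complex.exp (-(r*t)))
    (F' := fun (r : ℂ) (t : ℝ) => (t:ℂ)^(a-1) * (Complex.exp (-(r*t)) * (-t)))
    (bound := fun t : ℝ => t ^ a.re * Real.exp (-(r.re / 2 * t)))
    hs ?_ (aux_int r hr a ha) ?_ ?_ (aux_int_real _ _ (by linarith) (by linarith)) ?_).2.differentiableAt
  · filter_upwards [hs] with w hw
    have hw' : r.re / 2 < w.re := hw
    exact (aux_int w (by linarith) a ha).aestronglyMeasurable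
  · have h1 := (aux_int r hr a ha).aestronglyMeasurable
    have h2 : AEStronglyMeasurable (fun t : ℝ => (-t : ℂ)) (volume.restrict (Ioi 0)) :=
      Continuous.aestronglyMeasurable (by fun_prop)
    refine (h1.mul h2).congr (Filter.Eventually.of_forall fun t => ?_)
    simp [mul_assoc]
  · refine (ae_restrict_mem measurableSet_Ioi).mono fun t ht w hw => ?_
    have ht' : 0 < t := ht
    have hw' : r.re / 2 < w.re := hw
    rw [norm_mul, norm_mul, Complex.norm_cpow_eq_rpow_re_of_pos ht, Complex.norm_exp, norm_neg,
      Complex.norm_real, Real.norm_of_nonneg ht'.le]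
    have e : t ^ a.re = t ^ (a - 1).re * t := by
      simp [Real.rpow_sub_one ht'.ne', ht'.ne']
    rw [e, mul_assoc, mul_comm t]
    gcongr
    simp
    nlinarith
  · refine Filter.Eventually.of_forall fun t w _ => ?_
    refine HasDerivAt.const_mul _ (HasDerivAt.cexp ?_)
    simpa using ((hasDerivAt_id w).mul_const (t:ℂ)).fun_neg

lemma aux_eq {r : ℂ} {a : ℂ} (ha : 0 < a.re) (hr : 0 < r.re) :
    ∫ t in Ioi (0:ℝ), (t:ℂ)^(a-1) * Complex.exp (-(r*t)) = (1/r)^a * Complex.Gamma a := by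
  have ho : IsOpen {w : ℂ | 0 < w.re} := isOpen_lt continuous_const Complex.continuous_re
  have hA : AnalyticOnNhd ℂ (fun r : ℂ => ∫ t in Ioi (0:ℝ), (t:ℂ)^(a-1) * Complex.exp (-(r*t)))
      {w : ℂ | 0 < w.re} := DifferentiableOn.analyticOnNhd
    (fun w hw => (aux_deriv w hw a ha).differentiableWithinAt) ho
  have hB : AnalyticOnNhd ℂ (fun r : ℂ => (1/r)^a * Complex.Gamma a) {w : ℂ | 0 < w.re} := by
    refine DifferentiableOn.analyticOnNhd (fun w hw => ?_) ho
    have hw' : 0 < w.re := hw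
    have h0 : w ≠ 0 := by rintro rfl; simp at hw'
    refine (DifferentiableAt.mul_const (DifferentiableAt.cpow_const ?_ ?_) _).differentiableWithinAt
    · exact (differentiableAt_const _).div differentiableAt_id h0
    · left
      rw [one_div, Complex.inv_re]
      exact div_pos hw' (Complex.normSq_pos.2 h0)
  have hpre : IsPreconnected {w : ℂ | 0 < w.re} := (convex_halfSpace_re_gt 0).isPreconnected
  refine hA.eqOn_of_preconnected_of_frequently_eq hB hpre (z₀ := 1) (by simp) ?_ hr
  have ht : Filter.Tendsto (fun x : ℝ => (x:ℂ)) (nhdsWithin 1 {1}ᶜ) (nhdsWithin 1 {1}ᶜ) := by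
    refine tendsto_nhdsWithin_iff.2 ⟨?_, ?_⟩
    · have : ContinuousAt (fun x : ℝ => (x:ℂ)) 1 := by fun_prop
      simpa [ContinuousAt] using this.tendsto.mono_left nhdsWithin_le_nhds
    · filter_upwards [self_mem_nhdsWithin] with x hx
      simpa using hx
  refine ht.frequently (Filter.Eventually.frequently ?_)
  filter_upwards [nhdsWithin_le_nhds (Ioi_mem_nhds (one_pos : (0:ℝ) < 1))] with x hx
  exact Complex.integral_cpow_mul_exp_neg_mul_Ioi ha hx

lemma aux_exp_abs (b : ℝ) (hb : 0 < b) : Integrable fun t : ℝ => Real.exp (-(b * |t|)) := by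
  rw [← integrableOn_univ, ← Iic_union_Ioi (a := (0:ℝ)), integrableOn_union]
  constructor
  · refine (integrableOn_exp_mul_Iic hb 0).congr_fun (fun t ht => ?_) measurableSet_Iic
    have : t ≤ 0 := ht
    simp [abs_of_nonpos this]
  · refine (integrableOn_exp_mul_Ioi (neg_lt_zero.2 hb) 0).congr_fun (fun t ht => ?_) measurableSet_Ioi
    have : 0 < t := ht
    simp [abs_of_pos this]

lemma aux_bound (r : ℂ) (hr : 0 < r.re) (a : ℂ) (ha : 0 < a.re) :
    ‖(1/r)^a * Complex.Gamma a‖ ≤ ∫ t in Ioi (0:ℝ), t^(a.re-1) * Real.exp (-(r.re*t)) := by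
  rw [← aux_eq ha hr]
  refine (norm_integral_le_integral_norm _).trans (le_of_eq ?_)
  refine setIntegral_congr_fun measurableSet_Ioi fun t ht => ?_
  rw [norm_mul, Complex.norm_cpow_eq_rpow_re_of_pos ht, Complex.norm_exp]
  simp

lemma aux_norm (z : ℂ) (hz : z ≠ 0) (harg : |Complex.arg z| < Real.pi / 2) (a : ℂ) :
    ‖(1/z)^a‖ = ‖z‖^(-a.re) * Real.exp (Complex.arg z * a.im) := by
  have h1 : z.arg ≠ Real.pi := by
    intro h; rw [h, abs_of_pos Real.pi_pos] at harg; linarith [Real.pi_pos]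
  rw [one_div, Complex.inv_cpow _ _ h1, norm_inv, Complex.norm_cpow_of_ne_zero hz,
    Real.rpow_neg (norm_nonneg _), inv_div, div_eq_mul_inv, mul_comm]

lemma aux_gamma (σ : ℝ) (hσ : 0 < σ) (θ : ℝ) (h0 : 0 ≤ θ) (h1 : θ < Real.pi/2) :
    ∃ C : ℝ, ∀ t : ℝ, ‖Complex.Gamma (σ + t * Complex.I)‖ ≤ C * Real.exp (-(θ * |t|)) := by
  have key : ∀ φ : ℝ, |φ| = θ → ∀ t : ℝ, Real.exp (φ * t) * ‖Complex.Gamma (σ + t * Complex.I)‖ ≤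
      ∫ t in Ioi (0:ℝ), t^(σ-1) * Real.exp (-(Real.cos θ*t)) := by
    intro φ hφ t
    have hab : |φ| < Real.pi/2 := hφ ▸ h1
    have hre : (Complex.exp (φ * Complex.I)).re = Real.cos θ := by
      rw [Complex.exp_ofReal_mul_I_re, ← hφ, Real.cos_abs]
    have harg : (Complex.exp (φ * Complex.I)).arg = φ := by
      rw [Complex.arg_exp_mul_I, toIocMod_eq_self]
      constructor <;> linarith [abs_lt.1 hab, Real.pi_pos, (abs_lt.1 hab).1, (abs_lt.1 hab).2]
    have := aux_bound (Complex.exp (φ * Complex.I))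
      (by rw [hre]; exact Real.cos_pos_of_mem_Ioo ⟨by linarith [Real.pi_pos], h1⟩)
      (σ + t * Complex.I) (by simpa using hσ)
    rw [norm_mul, aux_norm _ (Complex.exp_ne_zero _) (by rwa [harg]), harg, hre,
      Complex.norm_exp_ofReal_mul_I] at this
    simpa using this
  refine ⟨∫ t in Ioi (0:ℝ), t^(σ-1) * Real.exp (-(Real.cos θ*t)), fun t => ?_⟩
  rw [Real.exp_neg, ← div_eq_mul_inv, le_div_iff₀ (Real.exp_pos _), mul_comm]
  rcases le_total 0 t with ht | ht
  · rw [abs_of_nonneg ht]; exact key θ (abs_of_nonneg h0) t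
  · rw [abs_of_nonpos ht, mul_neg, ← neg_mul]; exact key (-θ) (by rw [abs_neg, abs_of_nonneg h0]) t

lemma aux_vert (z : ℂ) (σ : ℝ) (hz : z ≠ 0) (harg : |Complex.arg z| < Real.pi / 2) (hσ : 0 < σ) :
    Integrable fun t : ℝ => (1/z)^((σ:ℂ) + t * Complex.I) * Complex.Gamma (σ + t * Complex.I) := by
  obtain ⟨θ, h1, h2⟩ := exists_between harg
  obtain ⟨C, hC⟩ := aux_gamma σ hσ θ ((abs_nonneg _).trans h1.le) h2
  have hi : Integrable fun t : ℝ => Real.exp (-((θ - |z.arg|) * |t|)) := aux_exp_abs _ (sub_pos.2 h1)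
  refine (hi.const_mul (‖z‖^(-σ) * C)).mono' ?_ ?_
  · refine Continuous.aestronglyMeasurable ?_
    refine Continuous.mul ?_ ?_
    · exact Continuous.const_cpow (by fun_prop) (Or.inl (by simpa using hz))
    · rw [continuous_iff_continuousAt]
      intro t
      refine ContinuousAt.comp (f := fun t : ℝ => (σ:ℂ) + t * Complex.I) (g := Complex.Gamma) ?_ (by fun_prop)
      refine (Complex.differentiableAt_Gamma _ fun m h => ?_).continuousAt
      have := congrArg Complex.re h
      simp at this
      linarith [(Nat.cast_nonneg m : (0:ℝ) ≤ m)]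
  · refine Filter.Eventually.of_forall fun t => ?_
    rw [norm_mul, aux_norm z hz harg]
    have e1 : Real.exp (z.arg * t) ≤ Real.exp (|z.arg| * |t|) := by
      rw [← abs_mul]; exact Real.exp_le_exp.2 (le_abs_self _)
    have := mul_le_mul e1 (hC t) (norm_nonneg _) (Real.exp_pos _).le
    have e2 : -((θ - |z.arg|) * |t|) = |z.arg| * |t| + -(θ * |t|) := by ring
    rw [e2, Real.exp_add]
    have h3 := mul_le_mul_of_nonneg_left this (Real.rpow_nonneg (norm_nonneg z) (-σ))
    simp only [Complex.add_re, Complex.ofReal_re, Complex.mul_re, Complex.I_re, Complex.ofReal_im, Complex.I_im, Complex.add_im, Complex.mul_im, mul_zero, mul_one, zero_add, add_zero, sub_zero, zero_mul]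
    calc _ = _ := by ring
      _ ≤ _ := h3
      _ = _ := by ring

lemma aux_main (z : ℂ) (σ : ℝ) (hz : z ≠ 0) (harg : |Complex.arg z| < Real.pi / 2) (hσ : 0 < σ) :
    (1 / (2 * Real.pi) : ℂ) * ∫ t : ℝ, (1/z)^((σ:ℂ) + t * Complex.I) * Complex.Gamma (σ + t * Complex.I)
      = Complex.exp (-z) := by
  have hre : 0 < z.re := by
    rcases Complex.abs_arg_lt_pi_div_two_iff.1 harg with h | h
    · exact h
    · exact absurd h hz
  have hm : ∀ t : ℝ, mellin (fun x : ℝ => Complex.exp (-(z * x))) (σ + t * Complex.I) =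
      (1/z)^((σ:ℂ) + t * Complex.I) * Complex.Gamma (σ + t * Complex.I) := fun t =>
    aux_eq (by simpa using hσ) hre
  have := mellinInv_mellin_eq σ (fun x : ℝ => Complex.exp (-(z * x))) one_pos
    (aux_int z hre σ (by simpa using hσ))
    (by unfold Complex.VerticalIntegrable; simp_rw [hm]; exact aux_vert z σ hz harg hσ)
    (by fun_prop)
  simp only [mellinInv, hm] at this
  simpa using this

theorem cahen_mellin (z α : ℂ) (c : ℝ) (hz : z ≠ 0)
    (harg : |Complex.arg z| < Real.pi / 2) (hc : -α.re < c) :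
    (1 / (2 * Real.pi * Complex.I)) *
        ∫ t : ℝ, Complex.Gamma ((c : ℂ) + t * Complex.I + α) *
          z ^ (-((c : ℂ) + t * Complex.I)) * Complex.I =
      z ^ α * Complex.exp (-z) := by
  have h1 : z.arg ≠ Real.pi := by
    intro h; rw [h, abs_of_pos Real.pi_pos] at harg; linarith [Real.pi_pos]
  have hm := aux_main z (c + α.re) hz harg (by linarith)
  rw [← integral_add_right_eq_self _ α.im] at hm
  rw [← hm, integral_mul_const, mul_left_comm (z^α), ← integral_const_mul (z^α)]
  have : ∀ t : ℝ, Complex.Gamma ((c : ℂ) + t * Complex.I + α) *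
          z ^ (-((c : ℂ) + t * Complex.I)) = z^α * ((1/z)^(((c + α.re : ℝ):ℂ) + (t + α.im : ℝ) * Complex.I) * Complex.Gamma ((c + α.re : ℝ) + (t + α.im : ℝ) * Complex.I)) := by
    intro t
    have e : (((c + α.re : ℝ):ℂ) + (t + α.im : ℝ) * Complex.I) = (c : ℂ) + t * Complex.I + α := by
      conv_rhs => rw [← Complex.re_add_im α]
      push_cast; ring
    rw [e, one_div, Complex.inv_cpow _ _ h1, ← Complex.cpow_neg, ← mul_assoc, ← Complex.cpow_add _ _ hz, mul_comm]
    congr 2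
    ring
  simp_rw [this]
  have := Complex.I_ne_zero
  have : (Real.pi : ℂ) ≠ 0 := by exact_mod_cast Real.pi_ne_zero
  field_simp
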